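/- Let P ⊆ ℕ. If every point y of the spacing shift Σ_P satisfies d(y) = 0 (the support A_y has density zero), then (Σ_P, σ_P) is proximal: every pair of points x, y ∈ Σ_P satisfies liminf_{n→∞} d(σⁿx, σⁿy) = 0. -/

import Mathlib

open Filter Topology

/-- The spacing shift `Σ_P ⊆ {0,1}^ℕ` determined by `P ⊆ ℕ`: a `0`-`1` sequence `x`
(encoded as `x : ℕ → Bool`) belongs to `Σ_P` iff whenever two coordinates are `1`,
the (positive) distance between them lies in `P`. -/
def SpacingShift (P : Set ℕ) : Set (ℕ → Bool) :=
  {x | ∀ i j : ℕ, i < j → x i = true → x j = true → j - i ∈ P}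

/-- The left shift map `σ` on sequences. -/
def shift (x : ℕ → Bool) : ℕ → Bool := fun n => x (n + 1)

/-- The support `A_y = {i : y_i = 1}` of a point of the shift space. -/
def supp (x : ℕ → Bool) : Set ℕ := {i | x i = true}

/-- `A ⊆ ℕ` has density `d`, i.e. `|A ∩ {1,…,n}| / n → d`. -/
def HasDensity (A : Set ℕ) (d : ℝ) : Prop :=
  Tendsto (fun n : ℕ => (Nat.card (A ∩ Set.Icc 1 n : Set ℕ) : ℝ) / n) atTop (𝓝 d)

/-- The upper density `d̄(A) = limsup_n |A ∩ {1,…,n}| / n`. -/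
noncomputable def upperDensity (A : Set ℕ) : ℝ :=
  limsup (fun n : ℕ => (Nat.card (A ∩ Set.Icc 1 n : Set ℕ) : ℝ) / n) atTop

/-- The upper Banach density `d*(A)`: the limsup, as the window length tends to infinity,
of the maximal proportion of elements of `A` in a window of that length. -/
noncomputable def upperBanachDensity (A : Set ℕ) : ℝ :=
  limsup (fun n : ℕ =>
    ⨆ m : ℕ, (Nat.card (A ∩ Set.Icc m (m + n) : Set ℕ) : ℝ) / (n + 1)) atTop

/-- `D ⊆ ℕ` is a Δ-set: it contains the difference set `{s_i - s_j : i > j}` of some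
strictly increasing sequence of natural numbers. -/
def IsDeltaSet (D : Set ℕ) : Prop :=
  ∃ s : ℕ → ℕ, StrictMono s ∧ ∀ i j : ℕ, j < i → s i - s j ∈ D

/-- `D ⊆ ℕ` is a Δ*-set: it meets every Δ-set. -/
def IsDeltaStarSet (D : Set ℕ) : Prop :=
  ∀ D' : Set ℕ, IsDeltaSet D' → (D ∩ D').Nonempty

open Classical in
/-- The standard metric on the shift space: `d(x,y) = 2^{-min{n : x_n ≠ y_n}}`,
and `d(x,x) = 0`. -/
noncomputable def seqDist (x y : ℕ → Bool) : ℝ :=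
  if x = y then 0 else (2 : ℝ)⁻¹ ^ sInf {n : ℕ | x n ≠ y n}

/-- The set `FS((a_n))` of finite sums of a sequence of natural numbers:
all sums `a_{i_1} + ⋯ + a_{i_k}` with `i_1 < ⋯ < i_k`. -/
def FSseq (a : ℕ → ℕ) : Set ℕ :=
  {n | ∃ F : Finset ℕ, F.Nonempty ∧ n = ∑ i ∈ F, a i}

/-- `S ⊆ ℕ` is an IP-set: it contains the finite sums of some sequence of positive
natural numbers. -/
def IsIPSet (S : Set ℕ) : Prop :=
  ∃ a : ℕ → ℕ, (∀ n, 0 < a n) ∧ FSseq a ⊆ S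

/-- The set `FS(A)` of finite sums of distinct elements of a set `A ⊆ ℕ`. -/
def FSset (A : Set ℕ) : Set ℕ :=
  {n | ∃ F : Finset ℕ, ↑F ⊆ A ∧ F.Nonempty ∧ n = ∑ i ∈ F, i}

/-- The spacing shift `(Σ_P, σ_P)` is topologically transitive: some point of `Σ_P`
has forward orbit (under the shift) dense in `Σ_P`. -/
def IsTransitiveShift (P : Set ℕ) : Prop :=
  ∃ x ∈ SpacingShift P, SpacingShift P ⊆ closure {y : ℕ → Bool | ∃ n : ℕ, shift^[n] x = y}

/-- `E ⊆ ℕ` is density intersective: it meets the difference set `A - A` of every set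
`A ⊆ ℕ` of positive upper Banach density. -/
def DensityIntersective (E : Set ℕ) : Prop :=
  ∀ A : Set ℕ, 0 < upperBanachDensity A → ∃ a ∈ A, ∃ a' ∈ A, a' < a ∧ a - a' ∈ E

theorem shift_iterate_apply (n : ℕ) (x : ℕ → Bool) (i : ℕ) : shift^[n] x i = x (n + i) := by
  induction n generalizing x with
  | zero => simp
  | succ k ih =>
    rw [Function.iterate_succ_apply, ih, shift]
    congr 1
    omega

theorem seqDist_nonneg (x y : ℕ → Bool) : 0 ≤ seqDist x y := by
  unfold seqDist
  split_ifs <;> positivity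

theorem seqDist_le_of_agree {x y : ℕ → Bool} {N : ℕ} (h : ∀ i < N, x i = y i) :
    seqDist x y ≤ (2 : ℝ)⁻¹ ^ N := by
  unfold seqDist
  split_ifs with hxy
  · positivity
  · refine pow_le_pow_of_le_one (by norm_num) (by norm_num) ?_
    have hne : {n : ℕ | x n ≠ y n}.Nonempty := Function.ne_iff.mp hxy
    by_contra! hlt
    exact Nat.sInf_mem hne (h _ hlt)

/-- A set meeting every window of length `N` beyond `M` has at least `k` elements in
`{1, …, k (N + 1)}`, as soon as `k > M`. -/
theorem le_card_of_syndetic {C : Set ℕ} {M N k : ℕ}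
    (h : ∀ n ≥ M, ∃ i < N, n + i ∈ C) (hk : M < k) :
    k ≤ (C ∩ Set.Icc 1 (k * (N + 1))).ncard := by
  choose! f hfN hfC using h
  set g : ℕ → ℕ := fun j => M + 1 + j * N + f (M + 1 + j * N) with hg
  have hlt : ∀ j, g j < M + 1 + (j + 1) * N := fun j => by
    have := hfN (M + 1 + j * N) (by omega)
    simp only [hg, add_mul]
    omega
  have hmono : StrictMono g := strictMono_nat_of_lt_succ fun j =>
    (hlt j).trans_le (by simp only [hg]; omega)
  have hsub : g '' Set.Iio k ⊆ C ∩ Set.Icc 1 (k * (N + 1)) := by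
    rintro _ ⟨j, hj, rfl⟩
    have hmul : (j + 1) * N ≤ k * N := Nat.mul_le_mul_right N hj
    have := hlt j
    refine ⟨hfC _ (by omega), by simp only [hg]; omega, ?_⟩
    rw [mul_add]
    omega
  have hcard := Set.ncard_le_ncard hsub ((Set.finite_Icc _ _).inter_of_right _)
  rwa [Set.ncard_image_of_injective _ hmono.injective, Set.ncard_Iio_nat] at hcard

/-- The union of two sets of density zero has arbitrarily long gaps arbitrarily far out. -/
theorem exists_gap_of_hasDensity_zero {A B : Set ℕ} (hA : HasDensity A 0) (hB : HasDensity B 0)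
    (M N : ℕ) : ∃ n ≥ M, ∀ i < N, n + i ∉ A ∪ B := by
  by_contra! hcon
  have htend : Tendsto (fun k : ℕ => k * (N + 1)) atTop atTop :=
    tendsto_id.atTop_mul_const' (Nat.succ_pos N)
  have hsum := (hA.add hB).comp htend
  rw [add_zero] at hsum
  obtain ⟨k, hk, hMk⟩ := ((hsum.eventually (gt_mem_nhds
    (show (0 : ℝ) < 1 / (N + 1) by positivity))).and (eventually_gt_atTop M)).exists
  have hle := (le_card_of_syndetic hcon hMk).trans
    ((congrArg Set.ncard (Set.union_inter_distrib_right A B _)).le.trans (Set.ncard_union_le _ _))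
  have hle' : (k : ℝ) ≤ ((A ∩ Set.Icc 1 (k * (N + 1))).ncard : ℝ)
      + (B ∩ Set.Icc 1 (k * (N + 1))).ncard := mod_cast hle
  have hk0 : (0 : ℝ) < k := by exact_mod_cast (Nat.zero_le M).trans_lt hMk
  simp only [Function.comp_apply, Nat.card_coe_set_eq, ← add_div] at hk
  push_cast at hk
  rw [div_lt_div_iff₀ (by positivity) (by positivity)] at hk
  nlinarith

/-- If every point of `Σ_P` has support of density zero, then
`(Σ_P, σ_P)` is proximal. -/
theorem density_zero_implies_proximal (P : Set ℕ)
    (h : ∀ y ∈ SpacingShift P, HasDensity (supp y) 0) :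
    ∀ x ∈ SpacingShift P, ∀ y ∈ SpacingShift P,
      liminf (fun n : ℕ => seqDist (shift^[n] x) (shift^[n] y)) atTop = 0 := by
  intro x hx y hy
  have hnonneg : ∀ᶠ n in atTop, 0 ≤ seqDist (shift^[n] x) (shift^[n] y) :=
    Eventually.of_forall fun _ => seqDist_nonneg _ _
  have hfreq : ∀ N : ℕ, ∃ᶠ n in atTop,
      seqDist (shift^[n] x) (shift^[n] y) ≤ (2 : ℝ)⁻¹ ^ N := fun N => by
    refine frequently_atTop.mpr fun M => ?_
    obtain ⟨n, hn, hgap⟩ := exists_gap_of_hasDensity_zero (h x hx) (h y hy) M N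
    refine ⟨n, hn, seqDist_le_of_agree fun i hi => ?_⟩
    have := hgap i hi
    simp only [supp, Set.mem_union, Set.mem_ofPred_eq, not_or, Bool.not_eq_true] at this
    rw [shift_iterate_apply, shift_iterate_apply, this.1, this.2]
  refine le_antisymm (ge_of_tendsto' (tendsto_pow_atTop_nhds_zero_of_lt_one
    (by norm_num) (by norm_num : (2 : ℝ)⁻¹ < 1)) fun N =>
      liminf_le_of_frequently_le (hfreq N) (isBoundedUnder_of_eventually_ge hnonneg)) ?_
  exact le_liminf_of_le (IsCoboundedUnder.of_frequently_le (hfreq 0)) hnonneg
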